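/- Let X be a set equipped with two metrics d and d⁰, and let A ≥ 1 satisfy A⁻¹·d⁰(p,q) ≤ d(p,q) ≤ A·d⁰(p,q) for all p, q ∈ X. Let R₀, R₁ > 0, T ≥ 0, and 0 ≤ T₁ ≤ T₂. Let c₁, c₂ : [0,T] → X be unit-speed d-geodesics (d(cᵢ(s), cᵢ(t)) = |s − t|), and let αᵢ : [0,Tᵢ] → X be unit-speed d⁰-geodesics with αᵢ(0) = cᵢ(0) and αᵢ(Tᵢ) = cᵢ(T) for i = 1, 2. Assume: (i) d(c₁(0), c₂(0)) ≤ R₁ and d(c₁(T), c₂(T)) ≤ R₁; (ii) for i = 1, 2, the Hausdorff distance with respect to d between the image of cᵢ and the image of αᵢ is at most R₀; (iii) the function t ↦ d⁰(α₁(t), α₂(t)) is convex on [0, T₁]. Then d(c₁(t), c₂(t)) ≤ 4R₀ + (6A² + 1)·R₁ for all t ∈ [0, T]. -/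

import Mathlib

/-- Abstract form of Lemma 2.12 of the paper.  Here `dist` is the distance `d` of the
metric without conjugate points, and `d0` is the distance of a negatively curved
background metric, uniformly equivalent to `d` with constant `A`.  The geodesics
`c₁, c₂` for `d` on `[0,T]` have endpoints at `d`-distance at most `R₁`, each is at
Hausdorff distance at most `R₀` (for `d`) from a `d0`-geodesic `αᵢ` with the same
endpoints, and `t ↦ d0(α₁(t), α₂(t))` is convex on `[0, T₁]`.  Then
`d(c₁(t), c₂(t)) ≤ 4R₀ + (6A² + 1)R₁` on `[0,T]`. -/
theorem dist_le_of_endpoints_close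
    {X : Type*} [MetricSpace X] (d0 : X → X → ℝ)
    (hd0_symm : ∀ p q : X, d0 p q = d0 q p)
    (hd0_self : ∀ p : X, d0 p p = 0)
    (hd0_triangle : ∀ p q r : X, d0 p r ≤ d0 p q + d0 q r)
    (A : ℝ) (hA : 1 ≤ A)
    (hAeq : ∀ p q : X, A⁻¹ * d0 p q ≤ dist p q ∧ dist p q ≤ A * d0 p q)
    (R₀ R₁ : ℝ) (hR₀ : 0 < R₀) (hR₁ : 0 < R₁)
    (T : ℝ) (hT : 0 ≤ T) (T₁ T₂ : ℝ) (hT₁ : 0 ≤ T₁) (hT₁₂ : T₁ ≤ T₂)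
    (c₁ c₂ α₁ α₂ : ℝ → X)
    (hc₁ : ∀ s ∈ Set.Icc (0 : ℝ) T, ∀ t ∈ Set.Icc (0 : ℝ) T,
      dist (c₁ s) (c₁ t) = |s - t|)
    (hc₂ : ∀ s ∈ Set.Icc (0 : ℝ) T, ∀ t ∈ Set.Icc (0 : ℝ) T,
      dist (c₂ s) (c₂ t) = |s - t|)
    (hα₁ : ∀ s ∈ Set.Icc (0 : ℝ) T₁, ∀ t ∈ Set.Icc (0 : ℝ) T₁,
      d0 (α₁ s) (α₁ t) = |s - t|)
    (hα₂ : ∀ s ∈ Set.Icc (0 : ℝ) T₂, ∀ t ∈ Set.Icc (0 : ℝ) T₂,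
      d0 (α₂ s) (α₂ t) = |s - t|)
    (hα₁0 : α₁ 0 = c₁ 0) (hα₁T : α₁ T₁ = c₁ T)
    (hα₂0 : α₂ 0 = c₂ 0) (hα₂T : α₂ T₂ = c₂ T)
    (hend0 : dist (c₁ 0) (c₂ 0) ≤ R₁) (hendT : dist (c₁ T) (c₂ T) ≤ R₁)
    (hH₁ : Metric.hausdorffDist (c₁ '' Set.Icc (0 : ℝ) T) (α₁ '' Set.Icc (0 : ℝ) T₁) ≤ R₀)
    (hH₂ : Metric.hausdorffDist (c₂ '' Set.Icc (0 : ℝ) T) (α₂ '' Set.Icc (0 : ℝ) T₂) ≤ R₀)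
    (hconv : ConvexOn ℝ (Set.Icc (0 : ℝ) T₁) (fun t => d0 (α₁ t) (α₂ t))) :
    ∀ t ∈ Set.Icc (0 : ℝ) T, dist (c₁ t) (c₂ t) ≤ 4 * R₀ + (6 * A ^ 2 + 1) * R₁ := by
  have hA0 : 0 < A := by linarith
  have hb0 : ∀ p q : X, d0 p q ≤ A * dist p q := by
    intro p q
    have h := mul_le_mul_of_nonneg_left (hAeq p q).1 hA0.le
    rwa [mul_inv_cancel_left₀ hA0.ne'] at h
  have hT₂ : 0 ≤ T₂ := hT₁.trans hT₁₂
  have bc : ∀ c : ℝ → X, (∀ s ∈ Set.Icc (0 : ℝ) T, ∀ t ∈ Set.Icc (0 : ℝ) T,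
      dist (c s) (c t) = |s - t|) → Bornology.IsBounded (c '' Set.Icc (0 : ℝ) T) := by
    intro c hc
    refine Metric.isBounded_iff.2 ⟨T, ?_⟩
    rintro _ ⟨s, hs, rfl⟩ _ ⟨t, ht, rfl⟩
    rw [hc s hs t ht, abs_le]
    constructor <;> linarith [hs.1, hs.2, ht.1, ht.2]
  have ba : ∀ (S : ℝ) (a : ℝ → X), (∀ s ∈ Set.Icc (0 : ℝ) S, ∀ t ∈ Set.Icc (0 : ℝ) S,
      d0 (a s) (a t) = |s - t|) → Bornology.IsBounded (a '' Set.Icc (0 : ℝ) S) := by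
    intro S a ha
    refine Metric.isBounded_iff.2 ⟨A * S, ?_⟩
    rintro _ ⟨s, hs, rfl⟩ _ ⟨t, ht, rfl⟩
    refine (hAeq _ _).2.trans (mul_le_mul_of_nonneg_left ?_ hA0.le)
    rw [ha s hs t ht, abs_le]
    constructor <;> linarith [hs.1, hs.2, ht.1, ht.2]
  have ne : ∀ (S : ℝ) (a : ℝ → X), 0 ≤ S → (a '' Set.Icc (0 : ℝ) S).Nonempty :=
    fun S a hS => (Set.nonempty_Icc.2 hS).image a
  have f₁ := Metric.hausdorffEDist_ne_top_of_nonempty_of_bounded (ne T c₁ hT) (ne T₁ α₁ hT₁)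
    (bc c₁ hc₁) (ba T₁ α₁ hα₁)
  have f₂ := Metric.hausdorffEDist_ne_top_of_nonempty_of_bounded (ne T c₂ hT) (ne T₂ α₂ hT₂)
    (bc c₂ hc₂) (ba T₂ α₂ hα₂)
  have e0 : d0 (c₁ 0) (c₂ 0) ≤ A * R₁ :=
    (hb0 _ _).trans (mul_le_mul_of_nonneg_left hend0 hA0.le)
  have eT : d0 (c₁ T) (c₂ T) ≤ A * R₁ :=
    (hb0 _ _).trans (mul_le_mul_of_nonneg_left hendT hA0.le)
  have l₁ : d0 (c₁ 0) (c₁ T) = T₁ := by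
    rw [← hα₁0, ← hα₁T, hα₁ 0 ⟨le_rfl, hT₁⟩ T₁ ⟨hT₁, le_rfl⟩, zero_sub, abs_neg, abs_of_nonneg hT₁]
  have l₂ : d0 (c₂ 0) (c₂ T) = T₂ := by
    rw [← hα₂0, ← hα₂T, hα₂ 0 ⟨le_rfl, hT₂⟩ T₂ ⟨hT₂, le_rfl⟩, zero_sub, abs_neg, abs_of_nonneg hT₂]
  have hdiff : T₂ - T₁ ≤ 2 * (A * R₁) := by
    have h1 := hd0_triangle (c₂ 0) (c₁ 0) (c₂ T)
    have h2 := hd0_triangle (c₁ 0) (c₁ T) (c₂ T)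
    have h3 := hd0_symm (c₂ 0) (c₁ 0)
    linarith
  have hAR : 0 < A * R₁ := mul_pos hA0 hR₁
  have m0 : d0 (α₁ 0) (α₂ 0) ≤ 3 * (A * R₁) := by rw [hα₁0, hα₂0]; linarith
  have m1 : d0 (α₁ T₁) (α₂ T₁) ≤ 3 * (A * R₁) := by
    have h1 := hd0_triangle (α₁ T₁) (α₂ T₂) (α₂ T₁)
    have h2 := hα₂ T₂ ⟨hT₂, le_rfl⟩ T₁ ⟨hT₁, hT₁₂⟩
    rw [abs_of_nonneg (by linarith)] at h2
    have h3 : d0 (α₁ T₁) (α₂ T₂) ≤ A * R₁ := by rw [hα₁T, hα₂T]; exact eT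
    linarith
  have m : ∀ s ∈ Set.Icc (0 : ℝ) T₁, d0 (α₁ s) (α₂ s) ≤ 3 * (A * R₁) := by
    intro s hs
    exact (hconv.le_max_of_mem_Icc (Set.left_mem_Icc.2 hT₁) (Set.right_mem_Icc.2 hT₁) hs).trans
      (max_le m0 m1)
  intro t ht
  refine le_of_forall_pos_le_add fun ε hε => ?_
  obtain ⟨_, ⟨s, hs, rfl⟩, h1⟩ := Metric.exists_dist_lt_of_hausdorffDist_lt
    (Set.mem_image_of_mem c₁ ht) (show _ < R₀ + ε / 4 by linarith) f₁
  have hs2 : s ∈ Set.Icc (0 : ℝ) T₂ := ⟨hs.1, hs.2.trans hT₁₂⟩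
  obtain ⟨_, ⟨u, hu, rfl⟩, h2⟩ := Metric.exists_dist_lt_of_hausdorffDist_lt'
    (Set.mem_image_of_mem α₂ hs2) (show _ < R₀ + ε / 4 by linarith) f₂
  have h3 : dist (α₁ s) (α₂ s) ≤ 3 * A ^ 2 * R₁ := by
    have := mul_le_mul_of_nonneg_left (m s hs) hA0.le
    have := (hAeq (α₁ s) (α₂ s)).2
    linarith
  have h5 : dist (c₁ t) (c₂ u) ≤ 2 * R₀ + 3 * A ^ 2 * R₁ + ε / 2 := by
    have a1 := dist_triangle4 (c₁ t) (α₁ s) (α₂ s) (c₂ u)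
    have a2 := dist_comm (c₂ u) (α₂ s)
    linarith
  have z : (0 : ℝ) ∈ Set.Icc (0 : ℝ) T := ⟨le_rfl, hT⟩
  have k1 : dist (c₁ 0) (c₁ t) = t := by
    rw [hc₁ 0 z t ht, zero_sub, abs_neg, abs_of_nonneg ht.1]
  have k2 : dist (c₂ 0) (c₂ u) = u := by
    rw [hc₂ 0 z u hu, zero_sub, abs_neg, abs_of_nonneg hu.1]
  have k3 := dist_triangle4 (c₁ 0) (c₂ 0) (c₂ u) (c₁ t)
  have k4 := dist_triangle4 (c₂ 0) (c₁ 0) (c₁ t) (c₂ u)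
  rw [dist_comm (c₂ u) (c₁ t)] at k3
  rw [dist_comm (c₂ 0) (c₁ 0)] at k4
  have k5 : dist (c₂ u) (c₂ t) ≤ R₁ + dist (c₁ t) (c₂ u) := by
    rw [hc₂ u hu t ht, abs_le]
    constructor <;> linarith
  have k6 := dist_triangle (c₁ t) (c₂ u) (c₂ t)
  linarith
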